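/- Let μ be the Gauss measure, C > 0 and 0 < γ < 1 the mixing constants, and ψ a positive function with sets A_n^k = {x : a_k(x) ≥ ψ(n)}. Suppose 1 ≤ k₁ < ⋯ < k_r < l₁ < ⋯ < l_r are indices with 2^{i−1} < k_α ≤ 2^i and 2^{j−1} < l_β ≤ 2^j for all α, β, that both tuples satisfy the separation condition (each consecutive gap, including from index 1, is at least (log 2^i)² resp. (log 2^j)²), and that l₁ − k_r ≥ i². Then there exists a constant c₃ > 0 (depending only on C, γ, r) such that μ((⋂_{α=1}^r A_{2^i}^{k_α}) ∩ (⋂_{β=1}^r A_{2^j}^{l_β})) ≤ μ(A_{2^i}^1)^r · μ(A_{2^j}^1)^r · (1 + c₃ γ^i). -/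

import Mathlib

open MeasureTheory Filter Set

/-- The Gauss map. -/
noncomputable def gaussMap (x : ℝ) : ℝ := if x = 0 then 0 else 1 / x - ⌊(1 / x : ℝ)⌋

/-- The `k`-th partial quotient of the continued fraction expansion of `x` (for `k ≥ 1`). -/
noncomputable def cfa (k : ℕ) (x : ℝ) : ℕ := ⌊1 / (gaussMap^[k - 1] x)⌋₊

/-- The Gauss measure on `[0,1)`, with density `1/((1+x) log 2)` w.r.t. Lebesgue measure. -/
noncomputable def gaussμ : Measure ℝ :=
  (volume.restrict (Set.Ico (0 : ℝ) 1)).withDensity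
    fun x => ENNReal.ofReal (1 / ((1 + x) * Real.log 2))

/-- The set `A_n^k = {x ∈ [0,1) : a_k(x) ≥ ψ(n)}`. -/
noncomputable def Aset (ψ : ℕ → ℝ) (n k : ℕ) : Set ℝ :=
  {x ∈ Set.Ico (0 : ℝ) 1 | ψ n ≤ (cfa k x : ℝ)}


/-- Transition probabilities of the normalized transfer operator (digit `n+1`). -/
noncomputable def gkP (n : ℕ) (x : ℝ) : ℝ := (1 + x) / ((n + 1 + x) * (n + 2 + x))

/-- Inverse branches. -/
noncomputable def gkV (n : ℕ) (x : ℝ) : ℝ := 1 / (n + 1 + x)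

/-- The transfer operator restricted to digits in `S` (shifted by one). -/
noncomputable def gkU (S : Set ℕ) (g : ℝ → ℝ) (x : ℝ) : ℝ :=
  ∑' n : S, gkP n x * g (gkV n x)

/-- Cone of densities. -/
def gkCone (g : ℝ → ℝ) : Prop :=
  (∀ x ∈ Icc (0 : ℝ) 1, 0 ≤ g x) ∧
  ∀ x ∈ Icc (0 : ℝ) 1, ∀ y ∈ Icc (0 : ℝ) 1, x ≤ y →
    g y * (1 + x) ≤ g x * (1 + y) ∧ g x * (1 + x) ≤ g y * (1 + y)

def gkLip (L : ℝ) (g : ℝ → ℝ) : Prop :=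
  ∀ x ∈ Icc (0 : ℝ) 1, ∀ y ∈ Icc (0 : ℝ) 1, |g x - g y| ≤ L * |x - y|

lemma gkV_mem (n : ℕ) {x : ℝ} (hx : x ∈ Icc (0 : ℝ) 1) : gkV n x ∈ Icc (0 : ℝ) 1 := by
  obtain ⟨h0, h1⟩ := hx
  have hn : (0 : ℝ) ≤ n := Nat.cast_nonneg n
  unfold gkV
  constructor
  · positivity
  · rw [div_le_one (by positivity)]; linarith

lemma gkP_nonneg (n : ℕ) {x : ℝ} (hx : x ∈ Icc (0 : ℝ) 1) : 0 ≤ gkP n x := by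
  obtain ⟨h0, h1⟩ := hx
  unfold gkP; positivity

lemma gkP_eq (n : ℕ) {x : ℝ} (hx : x ∈ Icc (0 : ℝ) 1) :
    gkP n x = ((n + 1 : ℕ) : ℝ) / ((n + 1 : ℕ) + 1 + x) - (n : ℝ) / (n + 1 + x) := by
  obtain ⟨h0, h1⟩ := hx
  unfold gkP
  have hn : (0 : ℝ) ≤ n := Nat.cast_nonneg n
  push_cast
  have h3 : (n : ℝ) + 1 + x ≠ 0 := by positivity
  have h4 : (n : ℝ) + 2 + x ≠ 0 := by positivity
  have h5 : (n : ℝ) + 1 + 1 + x ≠ 0 := by positivity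
  field_simp
  ring

lemma gkP_sum (N : ℕ) {x : ℝ} (hx : x ∈ Icc (0 : ℝ) 1) :
    ∑ n ∈ Finset.range N, gkP n x = (N : ℝ) / (N + 1 + x) := by
  rw [Finset.sum_congr rfl (fun n _ => gkP_eq n hx)]
  rw [Finset.sum_range_sub (fun n : ℕ => (n : ℝ) / (n + 1 + x))]
  simp

lemma gkP_summable {x : ℝ} (hx : x ∈ Icc (0 : ℝ) 1) : Summable (fun n => gkP n x) := by
  refine summable_of_sum_range_le (c := 1) (fun n => gkP_nonneg n hx) (fun N => ?_)
  rw [gkP_sum N hx]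
  obtain ⟨h0, h1⟩ := hx
  rw [div_le_one (by positivity)]; linarith

lemma gkCone.le_two {g : ℝ → ℝ} (h : gkCone g) {x y : ℝ} (hx : x ∈ Icc (0 : ℝ) 1)
    (hy : y ∈ Icc (0 : ℝ) 1) : g x ≤ 2 * g y := by
  have a := h.1 x hx
  have b := h.1 y hy
  rcases le_total x y with hxy | hxy
  · have := (h.2 x hx y hy hxy).2
    nlinarith [hx.1, hx.2, hy.1, hy.2]
  · have := (h.2 y hy x hx hxy).1
    nlinarith [hx.1, hx.2, hy.1, hy.2]

lemma gkCone.lip {g : ℝ → ℝ} (h : gkCone g) {M : ℝ} (hM : ∀ x ∈ Icc (0 : ℝ) 1, g x ≤ M) :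
    gkLip M g := by
  have key : ∀ x ∈ Icc (0 : ℝ) 1, ∀ y ∈ Icc (0 : ℝ) 1, x ≤ y → |g x - g y| ≤ M * |x - y| := by
    intro x hx y hy hxy
    obtain ⟨h1, h2⟩ := h.2 x hx y hy hxy
    have a := h.1 x hx
    have b := h.1 y hy
    have a' := hM x hx
    have b' := hM y hy
    rw [abs_sub_comm x y, abs_of_nonneg (sub_nonneg.2 hxy), abs_le]
    have hd : 0 ≤ y - x := sub_nonneg.2 hxy
    have e1 : 0 ≤ (M - g x) * (y - x) := mul_nonneg (by linarith) hd
    have e2 : 0 ≤ (M - g y) * (y - x) := mul_nonneg (by linarith) hd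
    have x0 := hx.1
    have hM0 : 0 ≤ M * (y - x) := mul_nonneg (by linarith) hd
    constructor
    · by_contra hc
      push Not at hc
      nlinarith [mul_nonneg x0 hM0]
    · by_contra hc
      push Not at hc
      nlinarith [mul_nonneg x0 hM0]
  intro x hx y hy
  rcases le_total x y with hxy | hxy
  · exact key x hx y hy hxy
  · rw [abs_sub_comm, abs_sub_comm x y]; exact key y hy x hx hxy

lemma gkLip.cont {g : ℝ → ℝ} {L : ℝ} (h : gkLip L g) : ContinuousOn g (Icc 0 1) := by
  have : LipschitzOnWith (Real.toNNReal L) g (Icc 0 1) := by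
    refine LipschitzOnWith.of_dist_le_mul (fun x hx y hy => ?_)
    rw [Real.dist_eq, Real.dist_eq]
    refine (h x hx y hy).trans ?_
    exact mul_le_mul_of_nonneg_right (Real.le_coe_toNNReal L) (abs_nonneg _)
  exact this.continuousOn

lemma gkCone.cont {g : ℝ → ℝ} (h : gkCone g) : ContinuousOn g (Icc 0 1) :=
  (h.lip (M := 2 * g 0) (fun _ hx => h.le_two hx (by simp))).cont

lemma gkCone.summable {g : ℝ → ℝ} (h : gkCone g) {x : ℝ} (hx : x ∈ Icc (0 : ℝ) 1) :
    Summable (fun n => gkP n x * g (gkV n x)) := by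
  refine Summable.of_nonneg_of_le (fun n => mul_nonneg (gkP_nonneg n hx) (h.1 _ (gkV_mem n hx)))
    (fun n => mul_le_mul_of_nonneg_left (h.le_two (gkV_mem n hx) (y := 0) (by simp))
      (gkP_nonneg n hx)) ((gkP_summable hx).mul_right _)

lemma gkCone.term {g : ℝ → ℝ} (h : gkCone g) (n : ℕ) :
    gkCone (fun x => gkP n x * g (gkV n x)) := by
  refine ⟨fun x hx => mul_nonneg (gkP_nonneg n hx) (h.1 _ (gkV_mem n hx)), ?_⟩
  intro x hx y hy hxy
  have hu := gkV_mem n hx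
  have hv := gkV_mem n hy
  have hn : (0 : ℝ) ≤ n := Nat.cast_nonneg n
  have x0 := hx.1
  have y0 := hy.1
  have hvu : gkV n y ≤ gkV n x := by
    unfold gkV
    exact one_div_le_one_div_of_le (by positivity) (by linarith)
  obtain ⟨h1, h2⟩ := h.2 _ hv _ hu hvu
  have gu := h.1 _ hu
  have gv := h.1 _ hv
  have eu : 1 + gkV n x = (n + 2 + x) / (n + 1 + x) := by
    unfold gkV
    have : (n : ℝ) + 1 + x ≠ 0 := by positivity
    field_simp; ring
  have ev : 1 + gkV n y = (n + 2 + y) / (n + 1 + y) := by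
    unfold gkV
    have : (n : ℝ) + 1 + y ≠ 0 := by positivity
    field_simp; ring
  rw [eu, ev] at h1 h2
  simp only [gkP]
  generalize g (gkV n x) = a at *
  generalize g (gkV n y) = b at *
  obtain ⟨p, hp⟩ : ∃ p, p = (n : ℝ) + 1 + x := ⟨_, rfl⟩
  obtain ⟨q, hq⟩ : ∃ q, q = (n : ℝ) + 1 + y := ⟨_, rfl⟩
  have p0 : 0 < p := by rw [hp]; positivity
  have q0 : 0 < q := by rw [hq]; positivity
  have hpq : p ≤ q := by linarith
  have e1 : (n : ℝ) + 2 + x = p + 1 := by rw [hp]; ring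
  have e2 : (n : ℝ) + 2 + y = q + 1 := by rw [hq]; ring
  rw [e1, e2, ← hp, ← hq] at h1 h2 ⊢
  -- h1 : a * ((q+1)/q) ≤ b * ((p+1)/p), h2 : b * ((q+1)/q) ≤ a * ((p+1)/p)
  have h1' : a ≤ b * ((p + 1) / p) * (q / (q + 1)) := by
    have := mul_le_mul_of_nonneg_right h1 (show 0 ≤ q / (q + 1) by positivity)
    refine le_trans (le_of_eq ?_) this
    field_simp
  have h2' : b ≤ a * ((p + 1) / p) * (q / (q + 1)) := by
    have := mul_le_mul_of_nonneg_right h2 (show 0 ≤ q / (q + 1) by positivity)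
    refine le_trans (le_of_eq ?_) this
    field_simp
  constructor
  · calc (1 + y) / (q * (q + 1)) * b * (1 + x)
        ≤ (1 + y) / (q * (q + 1)) * (a * ((p + 1) / p) * (q / (q + 1))) * (1 + x) := by gcongr
      _ = (1 + x) * (1 + y) * a / (p * (p + 1)) * ((p + 1) / (q + 1)) ^ 2 := by
          field_simp
      _ ≤ (1 + x) * (1 + y) * a / (p * (p + 1)) * 1 := by
          gcongr
          apply pow_le_one₀ (by positivity)
          rw [div_le_one (by positivity)]; linarith
      _ = _ := by ring
  · calc (1 + x) / (p * (p + 1)) * a * (1 + x)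
        ≤ (1 + x) / (p * (p + 1)) * (b * ((p + 1) / p) * (q / (q + 1))) * (1 + x) := by gcongr
      _ = b * (q / (q + 1)) * ((1 + x) / p) ^ 2 := by
          field_simp
      _ ≤ b * (q / (q + 1)) * ((1 + y) / q) ^ 2 := by
          have : (1 + x) / p ≤ (1 + y) / q := by
            rw [div_le_div_iff₀ p0 q0, hp, hq]
            nlinarith
          gcongr
      _ = _ := by field_simp

lemma gkCone.U {g : ℝ → ℝ} (h : gkCone g) (S : Set ℕ) : gkCone (gkU S g) := by
  have hs : ∀ x ∈ Icc (0 : ℝ) 1, Summable (fun n : S => gkP n x * g (gkV n x)) :=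
    fun x hx => (h.summable hx).subtype S
  constructor
  · intro x hx
    exact tsum_nonneg (fun n => (h.term n).1 x hx)
  · intro x hx y hy hxy
    unfold gkU
    simp only [← tsum_mul_right]
    constructor
    · exact Summable.tsum_le_tsum (fun n => ((h.term n).2 x hx y hy hxy).1)
        ((hs y hy).mul_right _) ((hs x hx).mul_right _)
    · exact Summable.tsum_le_tsum (fun n => ((h.term n).2 x hx y hy hxy).2)
        ((hs x hx).mul_right _) ((hs y hy).mul_right _)

lemma gkV_sub (n : ℕ) {x y : ℝ} (hx : x ∈ Icc (0 : ℝ) 1) (hy : y ∈ Icc (0 : ℝ) 1) :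
    |gkV n x - gkV n y| ≤ |x - y| / ((n + 1) * (n + 1)) := by
  have hn : (0 : ℝ) ≤ n := Nat.cast_nonneg n
  have x0 := hx.1
  have y0 := hy.1
  have e : gkV n x - gkV n y = -(x - y) / ((n + 1 + x) * (n + 1 + y)) := by
    unfold gkV
    have : (n : ℝ) + 1 + x ≠ 0 := by positivity
    have : (n : ℝ) + 1 + y ≠ 0 := by positivity
    field_simp; ring
  rw [e, abs_div, abs_neg, abs_of_pos (show 0 < ((n : ℝ) + 1 + x) * (n + 1 + y) by positivity)]
  refine div_le_div_of_nonneg_left (abs_nonneg _) (by positivity) ?_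
  exact mul_le_mul (by linarith) (by linarith) (by positivity) (by positivity)

lemma gk_sum1 (N : ℕ) {x y L : ℝ} {g : ℝ → ℝ} (hL : 0 ≤ L) (hg : gkLip L g)
    (hx : x ∈ Icc (0 : ℝ) 1) (hy : y ∈ Icc (0 : ℝ) 1) :
    |∑ n ∈ Finset.range N, gkP n x * (g (gkV n x) - g (gkV n y))| ≤ 5 / 8 * (L * |x - y|) := by
  have hD : 0 ≤ L * |x - y| := by positivity
  have key : ∀ N, ∑ n ∈ Finset.range N, |gkP n x * (g (gkV n x) - g (gkV n y))| ≤
      (3 / 8 + 1 / 4 * ∑ n ∈ Finset.range N, gkP n x) * (L * |x - y|) := by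
    intro N
    induction N with
    | zero => simp; positivity
    | succ N ih =>
      rw [Finset.sum_range_succ, Finset.sum_range_succ]
      have hP := gkP_nonneg N hx
      have h1 : |g (gkV N x) - g (gkV N y)| ≤ L * (|x - y| / ((N + 1) * (N + 1))) :=
        (hg _ (gkV_mem N hx) _ (gkV_mem N hy)).trans
          (mul_le_mul_of_nonneg_left (gkV_sub N hx hy) hL)
      rw [abs_mul, abs_of_nonneg hP]
      rcases Nat.eq_zero_or_pos N with rfl | hN
      · simp only [Finset.range_zero, Finset.sum_empty]
        have h2 : |g (gkV 0 x) - g (gkV 0 y)| ≤ L * |x - y| := by simpa using h1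
        have h3 : gkP 0 x ≤ 1 / 2 := by
          have x0 := hx.1
          unfold gkP
          rw [div_le_div_iff₀ (by positivity) (by positivity)]
          push_cast; nlinarith
        nlinarith [mul_le_mul_of_nonneg_left h2 hP]
      · have h2 : |g (gkV N x) - g (gkV N y)| ≤ 1 / 4 * (L * |x - y|) := by
          refine h1.trans ?_
          have hN' : (1 : ℝ) ≤ N := by exact_mod_cast hN
          rw [← mul_div_assoc, div_le_iff₀ (by positivity)]
          nlinarith [mul_le_mul_of_nonneg_left (show (4 : ℝ) ≤ (N + 1) * (N + 1) by nlinarith) hD]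
        nlinarith [mul_le_mul_of_nonneg_left h2 hP]
  refine (Finset.abs_sum_le_sum_abs _ _).trans ((key N).trans ?_)
  have : ∑ n ∈ Finset.range N, gkP n x ≤ 1 := by
    rw [gkP_sum N hx]
    have x0 := hx.1
    rw [div_le_one (by positivity)]; linarith
  nlinarith

lemma gk_phi_sub (n : ℕ) {x y : ℝ} (hx : x ∈ Icc (0 : ℝ) 1) (hy : y ∈ Icc (0 : ℝ) 1) :
    |(n : ℝ) / (n + 1 + x) - (n : ℝ) / (n + 1 + y)| ≤ n / ((n + 1) * (n + 1)) * |x - y| := by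
  have hn : (0 : ℝ) ≤ n := Nat.cast_nonneg n
  have e : (n : ℝ) / (n + 1 + x) - (n : ℝ) / (n + 1 + y) = n * (gkV n x - gkV n y) := by
    unfold gkV; ring
  rw [e, abs_mul, abs_of_nonneg hn]
  refine (mul_le_mul_of_nonneg_left (gkV_sub n hx hy) hn).trans (le_of_eq ?_)
  ring

lemma gk_sum2 (N : ℕ) {x y L B : ℝ} {g : ℝ → ℝ} (hL : 0 ≤ L) (hg : gkLip L g)
    (hB : ∀ x ∈ Icc (0 : ℝ) 1, |g x| ≤ B)
    (hx : x ∈ Icc (0 : ℝ) 1) (hy : y ∈ Icc (0 : ℝ) 1) :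
    |∑ n ∈ Finset.range N, (gkP n x - gkP n y) * g (gkV n y)| ≤
      1 / 4 * (L * |x - y|) + B * |(N : ℝ) / (N + 1 + x) - (N : ℝ) / (N + 1 + y)| := by
  have hD : 0 ≤ L * |x - y| := by positivity
  have y0 := hy.1
  set d : ℕ → ℝ := fun n => (n : ℝ) / (n + 1 + x) - (n : ℝ) / (n + 1 + y) with hd
  have abel : ∀ N, ∑ n ∈ Finset.range N, (gkP n x - gkP n y) * g (gkV n y) =
      d N * g (gkV N y) -
        ∑ n ∈ Finset.range N, d (n + 1) * (g (gkV (n + 1) y) - g (gkV n y)) := by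
    intro N
    induction N with
    | zero => simp [hd]
    | succ N ih =>
      rw [Finset.sum_range_succ, Finset.sum_range_succ, ih]
      have : gkP N x - gkP N y = d (N + 1) - d N := by
        rw [gkP_eq N hx, gkP_eq N hy]; simp only [hd]; ring
      rw [this]; ring
  have key : ∀ N, ∑ n ∈ Finset.range N, |d (n + 1) * (g (gkV (n + 1) y) - g (gkV n y))| ≤
      (1 / 4 - 1 / (2 * (N + 1) * (N + 2))) * (L * |x - y|) := by
    intro N
    induction N with
    | zero => simp; norm_num
    | succ N ih =>
      rw [Finset.sum_range_succ]
      have hN : (0 : ℝ) ≤ N := Nat.cast_nonneg N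
      have h1 : |d (N + 1)| ≤ (N + 1) / ((N + 2) * (N + 2)) * |x - y| := by
        have := gk_phi_sub (N + 1) hx hy
        refine this.trans (le_of_eq ?_)
        push_cast; ring
      have h2 : |g (gkV (N + 1) y) - g (gkV N y)| ≤ L * (1 / ((N + 1) * (N + 2))) := by
        refine (hg _ (gkV_mem _ hy) _ (gkV_mem _ hy)).trans ?_
        refine mul_le_mul_of_nonneg_left ?_ hL
        have e : gkV (N + 1) y - gkV N y = - (1 / ((N + 1 + y) * (N + 2 + y))) := by
          unfold gkV
          push_cast
          have : (N : ℝ) + 1 + y ≠ 0 := by positivity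
          have : (N : ℝ) + 2 + y ≠ 0 := by positivity
          have : (N : ℝ) + 1 + 1 + y ≠ 0 := by positivity
          field_simp; ring
        rw [e, abs_neg, abs_of_nonneg (by positivity)]
        apply one_div_le_one_div_of_le (by positivity)
        exact mul_le_mul (by linarith) (by linarith) (by positivity) (by positivity)
      have h3 : |d (N + 1) * (g (gkV (N + 1) y) - g (gkV N y))| ≤
          (1 / (2 * (N + 1) * (N + 2)) - 1 / (2 * (N + 2) * (N + 3))) * (L * |x - y|) := by
        rw [abs_mul]
        calc _ ≤ ((N + 1) / ((N + 2) * (N + 2)) * |x - y|) * (L * (1 / ((N + 1) * (N + 2)))) := by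
              gcongr
          _ = 1 / ((N + 2) * (N + 2) * (N + 2)) * (L * |x - y|) := by field_simp
          _ ≤ _ := by
              refine mul_le_mul_of_nonneg_right ?_ hD
              have : 1 / (2 * ((N : ℝ) + 1) * (N + 2)) - 1 / (2 * (N + 2) * (N + 3)) =
                1 / ((N + 1) * (N + 2) * (N + 3)) := by field_simp; ring
              rw [this]
              apply one_div_le_one_div_of_le (by positivity)
              nlinarith
      have e : (2 * (((N + 1 : ℕ) : ℝ) + 1) * ((N + 1 : ℕ) + 2)) = 2 * (N + 2) * (N + 3) := by
        push_cast; ring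
      rw [e]
      linarith
  rw [abel]
  have h1 : |d N * g (gkV N y)| ≤ B * |d N| := by
    rw [abs_mul, mul_comm]
    exact mul_le_mul_of_nonneg_right (hB _ (gkV_mem N hy)) (abs_nonneg _)
  have h2 := (Finset.abs_sum_le_sum_abs _ _).trans (key N)
  have h3 : (1 / 4 - 1 / (2 * ((N : ℝ) + 1) * (N + 2))) * (L * |x - y|) ≤ 1 / 4 * (L * |x - y|) := by
    refine mul_le_mul_of_nonneg_right ?_ hD
    have : 0 ≤ 1 / (2 * ((N : ℝ) + 1) * (N + 2)) := by positivity
    linarith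
  have h4 := abs_sub (d N * g (gkV N y))
    (∑ n ∈ Finset.range N, d (n + 1) * (g (gkV (n + 1) y) - g (gkV n y)))
  linarith

lemma gk_contract {g : ℝ → ℝ} (h : gkCone g) {L : ℝ} (hL : 0 ≤ L) (hg : gkLip L g) :
    gkLip (7 / 8 * L) (gkU univ g) := by
  intro x hx y hy
  have hB : ∀ x ∈ Icc (0 : ℝ) 1, |g x| ≤ 2 * g 0 := fun x hx => by
    rw [abs_of_nonneg (h.1 x hx)]; exact h.le_two hx (by simp)
  have hU : ∀ x, gkU univ g x = ∑' n, gkP n x * g (gkV n x) := fun x =>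
    tsum_univ (fun n => gkP n x * g (gkV n x))
  rw [hU, hU]
  have t1 := ((h.summable hx).hasSum.tendsto_sum_nat.sub (h.summable hy).hasSum.tendsto_sum_nat).abs
  have t2 : Tendsto (fun N : ℕ => 5 / 8 * (L * |x - y|) + (1 / 4 * (L * |x - y|) +
      2 * g 0 * |(N : ℝ) / (N + 1 + x) - (N : ℝ) / (N + 1 + y)|)) atTop
      (nhds (5 / 8 * (L * |x - y|) + (1 / 4 * (L * |x - y|) + 2 * g 0 * |(1 : ℝ) - 1|))) := by
    have t3 : ∀ x ∈ Icc (0 : ℝ) 1,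
        Tendsto (fun N : ℕ => (N : ℝ) / (N + 1 + x)) atTop (nhds 1) := by
      intro x hx
      have := tendsto_natCast_div_add_atTop (𝕜 := ℝ) (1 + x)
      simpa only [add_assoc] using this
    exact tendsto_const_nhds.add (tendsto_const_nhds.add
      (tendsto_const_nhds.mul ((t3 x hx).sub (t3 y hy)).abs))
  have := le_of_tendsto_of_tendsto' t1 t2 (fun N => ?_)
  · refine this.trans (le_of_eq ?_)
    simp; ring
  · have e : ∑ n ∈ Finset.range N, gkP n x * g (gkV n x) -
        ∑ n ∈ Finset.range N, gkP n y * g (gkV n y) =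
        ∑ n ∈ Finset.range N, gkP n x * (g (gkV n x) - g (gkV n y)) +
        ∑ n ∈ Finset.range N, (gkP n x - gkP n y) * g (gkV n y) := by
      rw [← Finset.sum_sub_distrib, ← Finset.sum_add_distrib]
      exact Finset.sum_congr rfl (fun n _ => by ring)
    rw [e]
    exact (abs_add_le _ _).trans (add_le_add (gk_sum1 N hL hg hx hy) (gk_sum2 N hL hg hB hx hy))

/-- Gauss density. -/
noncomputable def gkRho (x : ℝ) : ENNReal := ENNReal.ofReal (1 / ((1 + x) * Real.log 2))

lemma gkRho_meas : Measurable gkRho := by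
  unfold gkRho; fun_prop

lemma gk_lint {F : Set ℝ} (hF : MeasurableSet F) (f : ℝ → ENNReal) :
    ∫⁻ x in F, f x ∂gaussμ = ∫⁻ x in F ∩ Ioo 0 1, gkRho x * f x := by
  have : gaussμ = (volume.restrict (Set.Ico (0 : ℝ) 1)).withDensity gkRho := rfl
  rw [this, setLIntegral_withDensity_eq_setLIntegral_mul_non_measurable _ gkRho_meas f hF
    (ae_of_all _ (fun x => ENNReal.ofReal_lt_top)), Measure.restrict_restrict hF]
  exact setLIntegral_congr ((ae_eq_refl F).inter Ioo_ae_eq_Ico.symm)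

lemma gk_univ : gaussμ univ = 1 := by
  have h := gk_lint MeasurableSet.univ (fun _ => 1)
  rw [setLIntegral_const, one_mul] at h
  rw [h, univ_inter]
  simp only [mul_one]
  have hl : 0 < Real.log 2 := Real.log_pos (by norm_num)
  have hc : ContinuousOn (fun x : ℝ => 1 / ((1 + x) * Real.log 2)) (Icc 0 1) := by
    apply ContinuousOn.div continuousOn_const (by fun_prop)
    intro x hx
    have := hx.1
    positivity
  have hi : IntegrableOn (fun x : ℝ => 1 / ((1 + x) * Real.log 2)) (Icc 0 1) :=
    hc.integrableOn_Icc
  unfold gkRho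
  rw [← ofReal_integral_eq_lintegral_ofReal (hi.mono_set Ioo_subset_Icc_self)
    ((ae_restrict_iff' measurableSet_Ioo).2 (ae_of_all _ (fun x hx => by
      have := hx.1
      simp only [Pi.zero_apply]
      positivity)))]
  rw [← integral_Ioc_eq_integral_Ioo, ← intervalIntegral.integral_of_le zero_le_one]
  rw [intervalIntegral.integral_eq_sub_of_hasDerivAt (f := fun x => Real.log (1 + x) / Real.log 2)]
  · norm_num
  · intro x hx
    rw [uIcc_of_le zero_le_one] at hx
    have h1 : (1 + x) ≠ 0 := by have := hx.1; positivity
    have := (((hasDerivAt_id x).const_add 1).log h1).div_const (Real.log 2)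
    refine this.congr_deriv ?_
    simp only [id]
    field_simp
  · rw [intervalIntegrable_iff_integrableOn_Icc_of_le zero_le_one]; exact hi

instance gk_prob : IsProbabilityMeasure gaussμ := ⟨gk_univ⟩

lemma gk_compl : gaussμ (Ico (0 : ℝ) 1)ᶜ = 0 := by
  have h := gk_lint (measurableSet_Ico (a := (0 : ℝ)) (b := 1)).compl (fun _ => 1)
  rw [setLIntegral_const, one_mul] at h
  rw [h]
  have : (Ico (0 : ℝ) 1)ᶜ ∩ Ioo 0 1 = ∅ := by
    ext x; simp only [mem_inter_iff, mem_compl_iff, mem_Ico, mem_Ioo, mem_empty_iff_false]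
    refine iff_false_intro ?_
    rintro ⟨h1, h2⟩
    exact h1 ⟨h2.1.le, h2.2⟩
  rw [this]; simp

lemma gaussMap_meas : Measurable gaussMap := by
  unfold gaussMap
  refine Measurable.ite (measurableSet_singleton 0) measurable_const ?_
  have : Measurable (fun x : ℝ => (⌊(1 / x : ℝ)⌋ : ℝ)) :=
    measurable_from_top.comp (Int.measurable_floor.comp (measurable_const.div measurable_id))
  exact (measurable_const.div measurable_id).sub this

/-- Points whose first digit minus one lies in `S`. -/
def gkA (S : Set ℕ) : Set ℝ := {x ∈ Ico (0 : ℝ) 1 | ∃ n ∈ S, ⌊1 / x⌋₊ = n + 1}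

lemma gkA_meas (S : Set ℕ) : MeasurableSet (gkA S) := by
  have h : Measurable (fun x : ℝ => ⌊1 / x⌋₊) :=
    Nat.measurable_floor.comp (measurable_const.div measurable_id)
  have : gkA S = Ico (0 : ℝ) 1 ∩ (fun x : ℝ => ⌊1 / x⌋₊) ⁻¹' {m | ∃ n ∈ S, m = n + 1} := rfl
  rw [this]
  exact measurableSet_Ico.inter (h (MeasurableSet.of_discrete))

lemma gk_floor (n : ℕ) {y : ℝ} (hy : y ∈ Ioo (0 : ℝ) 1) :
    gkV n y ∈ Ioo (0 : ℝ) 1 ∧ ⌊1 / gkV n y⌋₊ = n + 1 ∧ gaussMap (gkV n y) = y := by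
  have hn : (0 : ℝ) ≤ n := Nat.cast_nonneg n
  obtain ⟨y0, y1⟩ := hy
  have e : 1 / gkV n y = n + 1 + y := by unfold gkV; rw [one_div_one_div]
  have p : 0 < gkV n y := by unfold gkV; positivity
  refine ⟨⟨p, ?_⟩, ?_, ?_⟩
  · unfold gkV; rw [div_lt_one (by positivity)]; linarith
  · rw [e, Nat.floor_eq_iff (by positivity)]; push_cast; constructor <;> linarith
  · unfold gaussMap
    rw [if_neg p.ne', e]
    have : ⌊(n : ℝ) + 1 + y⌋ = (n : ℤ) + 1 := by
      rw [Int.floor_eq_iff]; push_cast; constructor <;> linarith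
    rw [this]; push_cast; ring

lemma gk_decomp (S : Set ℕ) (F : Set ℝ) :
    ((gkA S ∩ gaussMap ⁻¹' F) ∩ Ioo 0 1 : Set ℝ) =ᵐ[volume]
      ⋃ n : S, gkV n '' (F ∩ Ioo 0 1) := by
  have hc : (range (fun n : ℕ => 1 / ((n : ℝ) + 1))).Countable := countable_range _
  filter_upwards [hc.ae_notMem volume] with x hx
  apply propext
  change x ∈ (gkA S ∩ gaussMap ⁻¹' F) ∩ Ioo 0 1 ↔ x ∈ ⋃ n : S, gkV n '' (F ∩ Ioo 0 1)
  constructor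
  · rintro ⟨⟨⟨-, n, hn, hfl⟩, hF⟩, hx0, hx1⟩
    rw [mem_iUnion]
    have h1 : 0 ≤ 1 / x := by positivity
    rw [Nat.floor_eq_iff h1] at hfl
    have hT : gaussMap x = 1 / x - (n + 1) := by
      unfold gaussMap
      rw [if_neg hx0.ne']
      have : ⌊(1 / x : ℝ)⌋ = (n : ℤ) + 1 := by
        rw [Int.floor_eq_iff]; have := hfl.1; have := hfl.2; push_cast at *
        constructor <;> linarith
      rw [this]; push_cast; ring
    refine ⟨⟨n, hn⟩, gaussMap x, ⟨hF, ?_⟩, ?_⟩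
    · rw [hT]
      have a := hfl.1
      have b := hfl.2
      push_cast at a b
      constructor
      · rcases lt_or_eq_of_le a with a | a
        · linarith
        · exfalso; apply hx; refine ⟨n, ?_⟩
          simp only [a, one_div_one_div]
      · linarith
    · simp only [gkV]; rw [hT]
      have : (n : ℝ) + 1 + (1 / x - (n + 1)) = 1 / x := by ring
      rw [this, one_div_one_div]
  · rw [mem_iUnion]
    rintro ⟨⟨n, hn⟩, y, ⟨hF, hy⟩, rfl⟩
    obtain ⟨h1, h2, h3⟩ := gk_floor n hy
    refine ⟨⟨⟨Ioo_subset_Ico_self h1, n, hn, h2⟩, ?_⟩, h1⟩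
    simp only [mem_preimage]
    rw [h3]; exact hF

lemma gkV_inj (n : ℕ) : InjOn (gkV n) (Ioo 0 1) := by
  intro x hx y hy h
  rw [← (gk_floor n hx).2.2, ← (gk_floor n hy).2.2, h]

lemma gkV_deriv (n : ℕ) {x : ℝ} (hx : x ∈ Ioo (0 : ℝ) 1) :
    HasDerivAt (gkV n) (-1 / (n + 1 + x) ^ 2) x := by
  have h : (n : ℝ) + 1 + x ≠ 0 := by have := hx.1; positivity
  have := ((hasDerivAt_id x).const_add ((n : ℝ) + 1)).inv h
  have e : gkV n = (fun x => (n : ℝ) + 1 + id x)⁻¹ := by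
    ext x; simp [gkV]
  rw [e]
  simpa using this

lemma gk_step (S : Set ℕ) {g : ℝ → ℝ} (hg : gkCone g) {F : Set ℝ} (hF : MeasurableSet F) :
    ∫⁻ x in gkA S ∩ gaussMap ⁻¹' F, ENNReal.ofReal (g x) ∂gaussμ =
      ∫⁻ x in F, ENNReal.ofReal (gkU S g x) ∂gaussμ := by
  rw [gk_lint ((gkA_meas S).inter (gaussMap_meas hF)), gk_lint hF,
    setLIntegral_congr (gk_decomp S F)]
  have hm : MeasurableSet (F ∩ Ioo (0 : ℝ) 1) := hF.inter measurableSet_Ioo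
  have hd : ∀ n : ℕ, ∀ x ∈ F ∩ Ioo (0 : ℝ) 1,
      HasDerivWithinAt (gkV n) (-1 / (n + 1 + x) ^ 2) (F ∩ Ioo 0 1) x :=
    fun n x hx => (gkV_deriv n hx.2).hasDerivWithinAt
  have hi : ∀ n : ℕ, InjOn (gkV n) (F ∩ Ioo 0 1) := fun n =>
    (gkV_inj n).mono inter_subset_right
  rw [lintegral_iUnion]
  · have e1 : ∀ n : S, ∫⁻ x in gkV n '' (F ∩ Ioo 0 1), gkRho x * ENNReal.ofReal (g x) =
        ∫⁻ x in F ∩ Ioo 0 1, gkRho x * ENNReal.ofReal (gkP n x * g (gkV n x)) := by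
      intro n
      rw [lintegral_image_eq_lintegral_abs_deriv_mul hm (hd n) (hi n)]
      refine setLIntegral_congr_fun hm (fun x hx => ?_)
      have x0 := hx.2.1
      have hl : 0 < Real.log 2 := Real.log_pos (by norm_num)
      have hv := (gk_floor n hx.2).1.1
      have hP := gkP_nonneg n (Ioo_subset_Icc_self hx.2)
      have key : |(-1 : ℝ) / ((n : ℕ) + 1 + x) ^ 2| * (1 / ((1 + gkV n x) * Real.log 2)) =
          1 / ((1 + x) * Real.log 2) * gkP n x := by
        have : |(-1 : ℝ) / ((n : ℕ) + 1 + x) ^ 2| = 1 / ((n : ℕ) + 1 + x) ^ 2 := by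
          rw [abs_div, abs_neg, abs_one, abs_of_nonneg (by positivity)]
        rw [this]
        unfold gkP gkV
        have : (((n : ℕ) : ℝ) + 1 + x) ≠ 0 := by positivity
        have : (((n : ℕ) : ℝ) + 2 + x) ≠ 0 := by positivity
        have e : 1 + 1 / (((n : ℕ) : ℝ) + 1 + x) =
            (((n : ℕ) : ℝ) + 2 + x) / (((n : ℕ) : ℝ) + 1 + x) := by
          field_simp; ring
        rw [e]
        field_simp
      unfold gkRho
      rw [← mul_assoc, ← ENNReal.ofReal_mul (abs_nonneg _), key,
        ENNReal.ofReal_mul (by positivity), ENNReal.ofReal_mul hP, mul_assoc]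
    rw [tsum_congr e1, ← lintegral_tsum]
    · refine setLIntegral_congr_fun hm (fun x hx => ?_)
      have hx' := Ioo_subset_Icc_self hx.2
      rw [ENNReal.tsum_mul_left]
      congr 1
      unfold gkU
      rw [ENNReal.ofReal_tsum_of_nonneg (f := fun n : S => gkP n x * g (gkV n x)) (fun n => (hg.term n).1 x hx')
        ((hg.summable hx').subtype S)]
    · intro n
      refine gkRho_meas.aemeasurable.mul (ENNReal.measurable_ofReal.comp_aemeasurable ?_)
      have h1 : AEMeasurable (fun x => gkP n x * g (gkV n x)) (volume.restrict (Icc 0 1)) :=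
        (hg.term n).cont.aemeasurable measurableSet_Icc
      exact h1.mono_set (inter_subset_right.trans Ioo_subset_Icc_self)
  · intro n
    exact hm.image_of_continuousOn_injOn (fun x hx => (hd n x hx).continuousWithinAt) (hi n)
  · intro n m hnm
    rw [Function.onFun, Set.disjoint_left]
    rintro x ⟨y, hy, rfl⟩ ⟨z, hz, hzy⟩
    apply hnm
    have h1 := (gk_floor n hy.2).2.1
    have h2 := (gk_floor m hz.2).2.1
    rw [hzy, h1] at h2
    exact Subtype.ext (by omega)

/-- `g` is the density of the image under `T^k` of the Gauss measure restricted to `E`. -/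
def gkDens (E : Set ℝ) (k : ℕ) (g : ℝ → ℝ) : Prop :=
  ∀ F : Set ℝ, MeasurableSet F →
    gaussμ (E ∩ gaussMap^[k] ⁻¹' F) = ∫⁻ x in F, ENNReal.ofReal (g x) ∂gaussμ

lemma gkDens.mass {E : Set ℝ} {k : ℕ} {g : ℝ → ℝ} (h : gkDens E k g) :
    gaussμ E = ∫⁻ x, ENNReal.ofReal (g x) ∂gaussμ := by
  have := h univ MeasurableSet.univ
  simpa using this

lemma gkDens.digit {E : Set ℝ} {k : ℕ} {g : ℝ → ℝ} (h : gkDens E k g) (hg : gkCone g)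
    (S : Set ℕ) : gkDens (E ∩ gaussMap^[k] ⁻¹' (gkA S)) (k + 1) (gkU S g) := by
  intro F hF
  rw [← gk_step S hg hF, ← h _ ((gkA_meas S).inter (gaussMap_meas hF))]
  congr 1
  rw [Function.iterate_succ', preimage_comp, preimage_inter, inter_assoc]

lemma gkA_univ : (gkA univ : Set ℝ) =ᵐ[gaussμ] (univ : Set ℝ) := by
  rw [ae_eq_univ]
  have h := gk_lint (gkA_meas univ).compl (fun _ => 1)
  rw [setLIntegral_const, one_mul] at h
  rw [h]
  have : (gkA univ)ᶜ ∩ Ioo 0 1 = ∅ := by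
    rw [eq_empty_iff_forall_notMem]
    rintro x ⟨h1, h2⟩
    apply h1
    refine ⟨Ioo_subset_Ico_self h2, ⌊1 / x⌋₊ - 1, mem_univ _, ?_⟩
    have : 1 ≤ ⌊1 / x⌋₊ := by
      rw [Nat.one_le_floor_iff, le_div_iff₀ h2.1]; linarith [h2.2]
    omega
  rw [this]; simp

lemma gkDens.shift {E : Set ℝ} {k : ℕ} {g : ℝ → ℝ} (h : gkDens E k g) (hg : gkCone g) :
    gkDens E (k + 1) (gkU univ g) := by
  intro F hF
  rw [← gk_step univ hg hF, Function.iterate_succ', preimage_comp, h _ (gaussMap_meas hF)]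
  refine setLIntegral_congr ?_
  have := gkA_univ.inter (ae_eq_refl (μ := gaussμ) (gaussMap ⁻¹' F))
  rw [univ_inter] at this
  exact this.symm

lemma gk_iter {E : Set ℝ} {k : ℕ} {g : ℝ → ℝ} (h : gkDens E k g) (hg : gkCone g) {L : ℝ}
    (hL : 0 ≤ L) (hl : gkLip L g) (m : ℕ) : ∃ f, gkCone f ∧ gkDens E (k + m) f ∧
      gkLip ((7 / 8) ^ m * L) f := by
  induction m with
  | zero => exact ⟨g, hg, h, by simpa using hl⟩
  | succ m ih =>
    obtain ⟨f, hf, hd, hf'⟩ := ih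
    refine ⟨_, hf.U univ, hd.shift hf, ?_⟩
    have := gk_contract hf (by positivity) hf'
    rwa [← mul_assoc, ← pow_succ'] at this

lemma gk_ae : ∀ᵐ x ∂gaussμ, x ∈ Icc (0 : ℝ) 1 := by
  have : ∀ᵐ x ∂gaussμ, x ∈ Ico (0 : ℝ) 1 := by
    rw [ae_iff]; exact gk_compl
  filter_upwards [this] with x hx using Ico_subset_Icc_self hx

lemma gk_avg {h : ℝ → ℝ} {a c : ℝ} (hh : ∀ y ∈ Icc (0 : ℝ) 1, a ≤ h y + c) :
    ENNReal.ofReal a ≤ ∫⁻ x, ENNReal.ofReal (h x) ∂gaussμ + ENNReal.ofReal c := by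
  calc ENNReal.ofReal a = ∫⁻ _, ENNReal.ofReal a ∂gaussμ := by simp
    _ ≤ ∫⁻ x, (ENNReal.ofReal (h x) + ENNReal.ofReal c) ∂gaussμ := by
        refine lintegral_mono_ae ?_
        filter_upwards [gk_ae] with x hx
        exact (ENNReal.ofReal_le_ofReal (hh x hx)).trans ENNReal.ofReal_add_le
    _ = _ := by rw [lintegral_add_right _ measurable_const]; simp

lemma gk_mix {E : Set ℝ} {k : ℕ} {g : ℝ → ℝ} (h : gkDens E k g) (hg : gkCone g) (S : Set ℕ)
    (m : ℕ) : ∃ f, gkCone f ∧ gkDens (E ∩ gaussMap^[k + m] ⁻¹' (gkA S)) (k + m + 1) f ∧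
      gaussμ (E ∩ gaussMap^[k + m] ⁻¹' (gkA S)) ≤
        gaussμ E * (gaussμ (gkA S) * ENNReal.ofReal (1 + 2 * (7 / 8) ^ m)) := by
  set M := (gaussμ E).toReal with hM
  have hM0 : 0 ≤ M := ENNReal.toReal_nonneg
  have hME : gaussμ E = ENNReal.ofReal M := (ENNReal.ofReal_toReal (measure_ne_top _ _)).symm
  have hgM : ∀ x ∈ Icc (0 : ℝ) 1, g x ≤ 2 * M := by
    intro x hx
    have h1 := gk_avg (h := g) (a := g x / 2) (c := 0)
      (fun y hy => by have := hg.le_two hx hy; linarith)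
    rw [← h.mass, hME, ENNReal.ofReal_zero, add_zero, ENNReal.ofReal_le_ofReal_iff hM0] at h1
    linarith
  obtain ⟨f, hf, hd, hl⟩ := gk_iter h hg (by positivity) (hg.lip hgM) m
  refine ⟨_, hf.U S, hd.digit hf S, ?_⟩
  have hc : (0 : ℝ) ≤ (7 / 8) ^ m * (2 * M) := by positivity
  have hfx : ∀ x ∈ Icc (0 : ℝ) 1, ENNReal.ofReal (f x) ≤
      gaussμ E * ENNReal.ofReal (1 + 2 * (7 / 8) ^ m) := by
    intro x hx
    have h1 := gk_avg (h := f) (a := f x) (c := (7 / 8) ^ m * (2 * M)) (fun y hy => by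
      have h2 := (le_abs_self _).trans (hl x hx y hy)
      have h3 : |x - y| ≤ 1 := by
        rw [abs_le]; constructor <;> linarith [hx.1, hx.2, hy.1, hy.2]
      have := mul_le_mul_of_nonneg_left h3 hc
      linarith)
    rw [← hd.mass, hME, ← ENNReal.ofReal_add hM0 hc] at h1
    refine h1.trans (le_of_eq ?_)
    rw [hME, ← ENNReal.ofReal_mul hM0]
    congr 1; ring
  rw [hd _ (gkA_meas S)]
  calc ∫⁻ x in gkA S, ENNReal.ofReal (f x) ∂gaussμ
      ≤ ∫⁻ _ in gkA S, gaussμ E * ENNReal.ofReal (1 + 2 * (7 / 8) ^ m) ∂gaussμ := by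
        refine setLIntegral_mono' (gkA_meas S) (fun x hx => hfx x (Ico_subset_Icc_self hx.1))
    _ = _ := by rw [setLIntegral_const]; ring

lemma gk_chain (S : Set ℕ) (d : ℕ) : ∀ (r : ℕ) (E : Set ℝ) (p : ℕ) (g : ℝ → ℝ),
    gkCone g → gkDens E p g → ∀ k : Fin r → ℕ,
    (∀ α : Fin r, (α : ℕ) = 0 → p + 1 + d ≤ k α) →
    (∀ α β : Fin r, (α : ℕ) + 1 = (β : ℕ) → k α + 1 + d ≤ k β) →
    ∃ p' g', gkCone g' ∧ gkDens (E ∩ ⋂ α, gaussMap^[k α - 1] ⁻¹' (gkA S)) p' g' ∧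
      (∀ q, p ≤ q → (∀ α, k α ≤ q) → p' ≤ q) ∧
      gaussμ (E ∩ ⋂ α, gaussMap^[k α - 1] ⁻¹' (gkA S)) ≤
        gaussμ E * (gaussμ (gkA S) * ENNReal.ofReal (1 + 2 * (7 / 8) ^ d)) ^ r := by
  intro r
  induction r with
  | zero =>
    intro E p g hg hd k _ _
    refine ⟨p, g, hg, ?_, fun q hq _ => hq, ?_⟩
    · simpa using hd
    · simp
  | succ r ih =>
    intro E p g hg hd k h0 h1
    have hk := h0 0 rfl
    obtain ⟨m, hm⟩ : ∃ m, k 0 - 1 = p + m := ⟨k 0 - 1 - p, by omega⟩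
    have hmd : d ≤ m := by omega
    obtain ⟨f, hf, hfd, hle⟩ := gk_mix hd hg S m
    rw [← hm] at hfd hle
    have hk1 : k 0 - 1 + 1 = k 0 := by omega
    rw [hk1] at hfd
    obtain ⟨p', g', hg', hd', hq', hle'⟩ := ih _ _ f hf hfd (fun α => k α.succ)
      (fun α hα => h1 0 α.succ (by simp [hα]))
      (fun α β hαβ => h1 α.succ β.succ (by simp; omega))
    have hset : E ∩ ⋂ α, gaussMap^[k α - 1] ⁻¹' (gkA S) =
        (E ∩ gaussMap^[k 0 - 1] ⁻¹' (gkA S)) ∩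
          ⋂ α : Fin r, gaussMap^[k α.succ - 1] ⁻¹' (gkA S) := by
      ext x
      simp only [mem_inter_iff, mem_iInter, Fin.forall_fin_succ, and_assoc]
    rw [hset]
    refine ⟨p', g', hg', hd', fun q _ hq => hq' q (hq 0) (fun α => hq α.succ), ?_⟩
    refine hle'.trans ?_
    rw [pow_succ', ← mul_assoc]
    refine mul_le_mul_left (hle.trans ?_) _
    refine mul_le_mul_right (mul_le_mul_right (ENNReal.ofReal_le_ofReal ?_) _) _
    have : (7 / 8 : ℝ) ^ m ≤ (7 / 8) ^ d := pow_le_pow_of_le_one (by norm_num) (by norm_num) hmd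
    linarith

lemma gk_start : gkDens (Ico (0 : ℝ) 1) 0 (fun _ => 1) := by
  intro F hF
  simp only [Function.iterate_zero, preimage_id, ENNReal.ofReal_one, setLIntegral_const, one_mul]
  refine measure_congr ?_
  have h : (Ico (0 : ℝ) 1 : Set ℝ) =ᵐ[gaussμ] (univ : Set ℝ) := by
    rw [ae_eq_univ]; exact gk_compl
  have := h.inter (ae_eq_refl (μ := gaussμ) F)
  rwa [univ_inter] at this

lemma gk_one : gkCone (fun _ => 1) := by
  refine ⟨fun _ _ => zero_le_one, fun x hx y hy hxy => ⟨?_, ?_⟩⟩ <;> simp <;> linarith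

lemma gaussMap_mem {x : ℝ} : gaussMap x ∈ Ico (0 : ℝ) 1 := by
  unfold gaussMap
  split_ifs
  · simp
  · exact ⟨Int.fract_nonneg _, Int.fract_lt_one _⟩

lemma gk_iterate_mem {x : ℝ} (hx : x ∈ Ico (0 : ℝ) 1) (k : ℕ) :
    gaussMap^[k] x ∈ Ico (0 : ℝ) 1 := by
  cases k with
  | zero => exact hx
  | succ k => rw [Function.iterate_succ_apply']; exact gaussMap_mem

lemma Aset_sub {ψ : ℕ → ℝ} (hψ : ∀ n, 0 < ψ n) (n k : ℕ) :
    Aset ψ n k ⊆ gaussMap^[k - 1] ⁻¹' (gkA {m | ψ n ≤ (m : ℝ) + 1}) := by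
  rintro x ⟨hx, h⟩
  have h1 : 1 ≤ cfa k x := by
    have : (0 : ℝ) < cfa k x := (hψ n).trans_le h
    exact_mod_cast this
  refine ⟨gk_iterate_mem hx _, cfa k x - 1, ?_, ?_⟩
  · rw [mem_ofPred_eq, Nat.cast_sub h1]; push_cast; linarith
  · change cfa k x = _; omega

lemma gkA_sub (ψ : ℕ → ℝ) (n : ℕ) : gkA {m | ψ n ≤ (m : ℝ) + 1} ⊆ Aset ψ n 1 := by
  rintro x ⟨hx, m, hm, h⟩
  refine ⟨hx, ?_⟩
  have : cfa 1 x = m + 1 := h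
  rw [this]; push_cast; exact hm

lemma gk_pow (t : ℝ) (h0 : 0 ≤ t) (h1 : t ≤ 1) (n : ℕ) :
    (1 + 4 * t) ^ n ≤ 1 + (5 ^ n - 1) * t := by
  induction n with
  | zero => simp
  | succ n ih =>
    have h5 : (1 : ℝ) ≤ 5 ^ n := one_le_pow₀ (by norm_num)
    have := mul_le_mul_of_nonneg_right ih (show 0 ≤ 1 + 4 * t by linarith)
    rw [pow_succ, pow_succ]
    nlinarith [mul_nonneg (mul_nonneg (sub_nonneg.2 h5) h0) (sub_nonneg.2 h1)]

lemma gk_rate (i : ℕ) : (7 / 8 : ℝ) ^ (i / 4) ≤ 2 * (97 / 100) ^ i := by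
  have h1 : (7 / 8 : ℝ) ^ (i / 4) ≤ ((97 / 100) ^ 4) ^ (i / 4) :=
    pow_le_pow_left₀ (by norm_num) (by norm_num) _
  rw [← pow_mul] at h1
  have h2 : (97 / 100 : ℝ) ^ i = (97 / 100) ^ (4 * (i / 4)) * (97 / 100) ^ (i % 4) := by
    rw [← pow_add, Nat.div_add_mod]
  have h3 : (97 / 100 : ℝ) ^ 3 ≤ (97 / 100) ^ (i % 4) :=
    pow_le_pow_of_le_one (by norm_num) (by norm_num) (by omega)
  have h4 : (0 : ℝ) < (97 / 100) ^ (4 * (i / 4)) := by positivity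
  rw [h2]
  nlinarith [mul_le_mul_of_nonneg_left h3 h4.le]

lemma gk_log {i j : ℕ} (hi : 1 ≤ i) (hij : i ≤ j) :
    (((i / 4 : ℕ)) : ℝ) ≤ (Real.log ((2 : ℝ) ^ j)) ^ 2 := by
  rw [Real.log_pow]
  have h1 : ((i / 4 : ℕ) : ℝ) ≤ (i : ℝ) / 4 := Nat.cast_div_le
  have h2 : (1 : ℝ) ≤ i := by exact_mod_cast hi
  have h3 : (i : ℝ) ≤ j := by exact_mod_cast hij
  have h4 := Real.log_two_gt_d9
  have h5 : (j : ℝ) / 2 ≤ j * Real.log 2 := by nlinarith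
  have h6 : ((j : ℝ) / 2) ^ 2 ≤ (j * Real.log 2) ^ 2 := pow_le_pow_left₀ (by linarith) h5 2
  nlinarith

theorem stmt_19 :
    ∃ γ : ℝ, 0 < γ ∧ γ < 1 ∧ ∀ r : ℕ, 1 ≤ r → ∃ c₃ : ℝ, 0 < c₃ ∧
      ∀ (ψ : ℕ → ℝ), (∀ n, 0 < ψ n) → ∀ i j : ℕ, ∀ k l : Fin r → ℕ,
        StrictMono k → StrictMono l →
        (∀ α : Fin r, 2 ^ (i - 1) < k α ∧ k α ≤ 2 ^ i) →
        (∀ β : Fin r, 2 ^ (j - 1) < l β ∧ l β ≤ 2 ^ j) →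
        -- separation of the tuple `k` at scale `2^i`, including the gap from index `1`
        (∀ α : Fin r, (α : ℕ) = 0 →
          (Real.log ((2 : ℝ) ^ i)) ^ 2 ≤ (k α : ℝ) - 1 - 1) →
        (∀ α β : Fin r, (α : ℕ) + 1 = (β : ℕ) →
          (Real.log ((2 : ℝ) ^ i)) ^ 2 ≤ (k β : ℝ) - (k α : ℝ) - 1) →
        -- separation of the tuple `l` at scale `2^j`, including the gap from index `1`
        (∀ β : Fin r, (β : ℕ) = 0 →
          (Real.log ((2 : ℝ) ^ j)) ^ 2 ≤ (l β : ℝ) - 1 - 1) →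
        (∀ α β : Fin r, (α : ℕ) + 1 = (β : ℕ) →
          (Real.log ((2 : ℝ) ^ j)) ^ 2 ≤ (l β : ℝ) - (l α : ℝ) - 1) →
        -- the tuples are ordered and `l₁ - k_r ≥ i²`
        (∀ α β : Fin r, k α + i ^ 2 ≤ l β) →
        gaussμ ((⋂ α : Fin r, Aset ψ (2 ^ i) (k α)) ∩ ⋂ β : Fin r, Aset ψ (2 ^ j) (l β)) ≤
          gaussμ (Aset ψ (2 ^ i) 1) ^ r * gaussμ (Aset ψ (2 ^ j) 1) ^ r *
            ENNReal.ofReal (1 + c₃ * γ ^ i) := by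
  refine ⟨97 / 100, by norm_num, by norm_num, fun r hr => ⟨5 ^ (2 * r), by positivity, ?_⟩⟩
  intro ψ hψ i j k l hk hl hk2 hl2 hk0 hk1 hl0 hl1 hkl
  have z : Fin r := ⟨0, hr⟩
  have hi : 1 ≤ i := by
    by_contra hc
    have : i = 0 := by omega
    subst this
    have := hk2 z
    simp at this
    omega
  have hij : i ≤ j := by
    have h1 : 2 ^ (i - 1) < 2 ^ j := by
      have := hk2 z
      have := hl2 z
      have := hkl z z
      omega
    have := (Nat.pow_lt_pow_iff_right (by norm_num)).1 h1
    omega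
  have gi := gk_log hi le_rfl
  have gj := gk_log hi hij
  set d := i / 4 with hd
  have hdi : d + 1 ≤ i ^ 2 := by
    have : i / 4 + 1 ≤ i := by omega
    nlinarith
  obtain ⟨p, g, hg, hD, hq, hle⟩ := gk_chain {m | ψ (2 ^ i) ≤ (m : ℝ) + 1} d r _ 0 _ gk_one
    gk_start k
    (fun α hα => by
      have := hk0 α hα
      have : ((0 + 1 + d : ℕ) : ℝ) ≤ k α := by push_cast; linarith
      exact_mod_cast this)
    (fun α β hαβ => by
      have := hk1 α β hαβ
      have : ((k α + 1 + d : ℕ) : ℝ) ≤ k β := by push_cast; linarith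
      exact_mod_cast this)
  obtain ⟨p', g', -, -, -, hle'⟩ := gk_chain {m | ψ (2 ^ j) ≤ (m : ℝ) + 1} d r _ p _ hg hD l
    (fun β hβ => by
      have h1 := hq (l β - i ^ 2) (Nat.zero_le _) (fun α => by have := hkl α β; omega)
      have := hkl β β
      have := hk2 β
      omega)
    (fun α β hαβ => by
      have := hl1 α β hαβ
      have : ((l α + 1 + d : ℕ) : ℝ) ≤ l β := by push_cast; linarith
      exact_mod_cast this)
  have hsub : (⋂ α : Fin r, Aset ψ (2 ^ i) (k α)) ∩ ⋂ β : Fin r, Aset ψ (2 ^ j) (l β) ⊆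
      (Ico (0 : ℝ) 1 ∩ ⋂ α, gaussMap^[k α - 1] ⁻¹' (gkA {m | ψ (2 ^ i) ≤ (m : ℝ) + 1})) ∩
        ⋂ β, gaussMap^[l β - 1] ⁻¹' (gkA {m | ψ (2 ^ j) ≤ (m : ℝ) + 1}) := by
    rintro x ⟨h1, h2⟩
    rw [mem_iInter] at h1 h2
    exact ⟨⟨(h1 z).1, mem_iInter.2 fun α => Aset_sub hψ _ _ (h1 α)⟩,
      mem_iInter.2 fun β => Aset_sub hψ _ _ (h2 β)⟩
  refine (measure_mono hsub).trans (hle'.trans ?_)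
  have hA := measure_mono (μ := gaussμ) (gkA_sub ψ (2 ^ i))
  have hB := measure_mono (μ := gaussμ) (gkA_sub ψ (2 ^ j))
  set X := ENNReal.ofReal (1 + 2 * (7 / 8 : ℝ) ^ d) with hX
  have hXX : X ^ r * X ^ r ≤ ENNReal.ofReal (1 + 5 ^ (2 * r) * (97 / 100) ^ i) := by
    rw [← pow_add, ← two_mul, hX, ← ENNReal.ofReal_pow (by positivity)]
    refine ENNReal.ofReal_le_ofReal ?_
    have t0 : (0 : ℝ) ≤ (97 / 100) ^ i := by positivity
    have t1 : (97 / 100 : ℝ) ^ i ≤ 1 := pow_le_one₀ (by norm_num) (by norm_num)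
    have h1 := gk_pow _ t0 t1 (2 * r)
    have h2 : (1 + 2 * (7 / 8 : ℝ) ^ d) ^ (2 * r) ≤ (1 + 4 * (97 / 100) ^ i) ^ (2 * r) :=
      pow_le_pow_left₀ (by positivity) (by have := gk_rate i; linarith) _
    linarith
  have h1 : gaussμ (Ico (0 : ℝ) 1) ≤ 1 := prob_le_one
  calc _ ≤ (1 * (gaussμ (Aset ψ (2 ^ i) 1) * X) ^ r) * (gaussμ (Aset ψ (2 ^ j) 1) * X) ^ r := by
        gcongr
        refine hle.trans ?_
        gcongr
    _ = gaussμ (Aset ψ (2 ^ i) 1) ^ r * gaussμ (Aset ψ (2 ^ j) 1) ^ r * (X ^ r * X ^ r) := by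
        rw [mul_pow, mul_pow]; ring
    _ ≤ _ := by gcongr
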